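/- Let (G_i)_{i∈ℕ} be a recursively enumerated family of finitely generated groups with computable left orders: there are a computable function n : ℕ → ℕ, surjective homomorphisms π_i from the free group on n(i) generators onto G_i, left-invariant linear orders ≤_i on each G_i, and a computable two-variable function assigning to each pair (i, w), where w is a word over the n(i) generators and their inverses, the sign of π_i(w) relative to the identity of (G_i, ≤_i). Then there exist a group H̃ generated by two elements having a computable left order and embeddings φ_i : G_i → H̃ that are simultaneously quasi-isometric and Frattini. -/

import Mathlib

-- The sign (−1, 0, or 1) of a group element relative to the identity,
-- with respect to a linear order `l`.
open Classical in
noncomputable def orderSign {H : Type*} [Group H] (l : LinearOrder H) (h : H) : ℤ :=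
  if l.lt h 1 then -1 else if h = 1 then 0 else 1

/-- A group is left-orderable if it carries a left-invariant linear order. -/
def IsLeftOrderable (G : Type*) [Group G] : Prop :=
  ∃ l : LinearOrder G, ∀ a b c : G, l.le b c → l.le (a * b) (a * c)

/-- A Frattini embedding: an injective homomorphism preserving and reflecting conjugacy. -/
def IsFrattini {G H : Type*} [Group G] [Group H] (φ : G →* H) : Prop :=
  Function.Injective φ ∧ ∀ a b : G, IsConj a b ↔ IsConj (φ a) (φ b)

/-- `X` is a (finite) generating set of the group. -/
def Generates {G : Type*} [Group G] (X : Finset G) : Prop :=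
  Subgroup.closure (X : Set G) = ⊤

/-- Word length of `g` with respect to the finite set `X`: the least length of a word
over `X ∪ X⁻¹` representing `g`. -/
noncomputable def wordLength {G : Type*} [Group G] (X : Finset G) (g : G) : ℕ :=
  sInf {n | ∃ w : List G, w.length = n ∧ (∀ a ∈ w, a ∈ X ∨ a⁻¹ ∈ X) ∧ w.prod = g}

/-- Quasi-isometric embedding with respect to finite generating sets `X` and `Y`. -/
noncomputable def IsQIEmbedding {G H : Type*} [Group G] [Group H]
    (X : Finset G) (Y : Finset H) (φ : G →* H) : Prop :=
  Function.Injective φ ∧ ∃ C k : ℝ, 0 < C ∧ 0 < k ∧ ∀ g : G,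
    (1 / C) * (wordLength X g : ℝ) - k ≤ (wordLength Y (φ g) : ℝ) ∧
    (wordLength Y (φ g) : ℝ) ≤ C * (wordLength X g : ℝ) + k

/-- Evaluation of a formal word (list of pairs (index, sign)) over the
enumerated sequence `x : ℕ → G`. -/
def evalWord {G : Type*} [Group G] (x : ℕ → G) (w : List (ℕ × Bool)) : G :=
  (w.map (fun p => if p.2 then x p.1 else (x p.1)⁻¹)).prod

/-- A computable left order on a countable group with respect to an enumerated
generating sequence `x : ℕ → G`. -/
def ComputableLeftOrderWrt {G : Type*} [Group G] (x : ℕ → G) : Prop :=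
  ∃ l : LinearOrder G, (∀ a b c : G, l.le b c → l.le (a * b) (a * c)) ∧
    Computable (fun w : List (ℕ × Bool) => orderSign l (evalWord x w))

/-- A computable left order on a finitely generated group, presented by
a surjection `π` from a free group of finite rank. -/
def ComputableLeftOrderVia {H : Type*} [Group H] {m : ℕ}
    (π : FreeGroup (Fin m) →* H) : Prop :=
  ∃ l : LinearOrder H, (∀ a b c : H, l.le b c → l.le (a * b) (a * c)) ∧
    Computable (fun w : List (Fin m × Bool) => orderSign l (π (FreeGroup.mk w)))

/-- The embedding `φ` is computable: one can compute, for each `i`, a word over the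
generators of `H` representing `φ (x i)`. -/
def ComputableEmbedding {G H : Type*} [Group G] [Group H] (x : ℕ → G) {m : ℕ}
    (π : FreeGroup (Fin m) →* H) (φ : G →* H) : Prop :=
  ∃ f : ℕ → List (Fin m × Bool), Computable f ∧ ∀ i, π (FreeGroup.mk (f i)) = φ (x i)

/-- Decidable membership problem for the image of `φ` in `H`, presented via `π`. -/
def DecidableMembership {G H : Type*} [Group G] [Group H] {m : ℕ}
    (π : FreeGroup (Fin m) →* H) (φ : G →* H) : Prop :=
  ComputablePred (fun w : List (Fin m × Bool) => π (FreeGroup.mk w) ∈ φ.range)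

/-- Decidable word problem for `H`, presented via `π`. -/
def DecidableWordProblemVia {H : Type*} [Group H] {m : ℕ}
    (π : FreeGroup (Fin m) →* H) : Prop :=
  ComputablePred (fun w : List (Fin m × Bool) => π (FreeGroup.mk w) = 1)

/-- A group is finitely presented: quotient of a finite-rank free group by the
normal closure of finitely many relators. -/
def IsFinitelyPresented (K : Type*) [Group K] : Prop :=
  ∃ (m : ℕ) (π : FreeGroup (Fin m) →* K) (R : Finset (FreeGroup (Fin m))),
    Function.Surjective π ∧ π.ker = Subgroup.normalClosure (R : Set (FreeGroup (Fin m)))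
set_option linter.unusedSectionVars false

namespace Emb

open Equiv

abbrev Wd := List (Fin 2 × Bool)

/-- The ambient group: families of permutations. -/
abbrev Amb (G : ℕ → Type) := ∀ i, Perm (ℤ × ℤ × G i)

section
variable {G : ℕ → Type} [∀ i, Group (G i)]

/-- Letters sit only at positions at least 2. -/
noncomputable def yy (y : ∀ i, ℤ → G i) (i : ℕ) (m : ℤ) : G i := if 2 ≤ m then y i m else 1

noncomputable def cc (y : ∀ i, ℤ → G i) (i : ℕ) (m k : ℤ) : G i := if 0 ≤ k then yy y i m else 1

lemma cc_one (y : ∀ i, ℤ → G i) (i : ℕ) (k : ℤ) : cc y i 1 k = 1 := by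
  simp [cc, yy]

def SS : Amb G := fun i =>
  { toFun := fun p => (p.1 + 1, p.2.1, p.2.2)
    invFun := fun p => (p.1 - 1, p.2.1, p.2.2)
    left_inv := fun p => by simp
    right_inv := fun p => by simp }

noncomputable def TT (y : ∀ i, ℤ → G i) : Amb G := fun i =>
  { toFun := fun p => (p.1, (if p.1 = 1 then p.2.1 + 1 else p.2.1), cc y i p.1 p.2.1 * p.2.2)
    invFun := fun p => (p.1, (if p.1 = 1 then p.2.1 - 1 else p.2.1), (cc y i p.1 p.2.1)⁻¹ * p.2.2)
    left_inv := fun p => by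
      obtain ⟨a, b, g⟩ := p
      by_cases h : a = 1
      · subst h; simp [cc_one]
      · simp [h]
    right_inv := fun p => by
      obtain ⟨a, b, g⟩ := p
      by_cases h : a = 1
      · subst h; simp [cc_one]
      · simp [h] }

lemma SS_apply (i : ℕ) (m k : ℤ) (g : G i) : SS (G := G) i (m, k, g) = (m + 1, k, g) := rfl
lemma SS_inv_apply (i : ℕ) (m k : ℤ) (g : G i) : (SS (G := G) i)⁻¹ (m, k, g) = (m - 1, k, g) := rfl
lemma TT_apply (y : ∀ i, ℤ → G i) (i : ℕ) (m k : ℤ) (g : G i) :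
    TT y i (m, k, g) = (m, (if m = 1 then k + 1 else k), cc y i m k * g) := rfl
lemma TT_inv_apply (y : ∀ i, ℤ → G i) (i : ℕ) (m k : ℤ) (g : G i) :
    (TT y i)⁻¹ (m, k, g) = (m, (if m = 1 then k - 1 else k), (cc y i m k)⁻¹ * g) := rfl

noncomputable def gens (y : ∀ i, ℤ → G i) : Fin 2 → Amb G := ![SS, TT y]

noncomputable def rho (y : ∀ i, ℤ → G i) : FreeGroup (Fin 2) →* Amb G := FreeGroup.lift (gens y)

def sg (b : Bool) : ℤ := if b then 1 else -1

def kk : Wd → ℤ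
  | [] => 0
  | (x, b) :: w => kk w + if x = 0 then sg b else 0

def EE : Wd → ℤ → ℤ
  | [], _ => 0
  | (x, b) :: w, c => EE w c + if x = 1 ∧ kk w = c then sg b else 0

noncomputable def UU (y : ∀ i, ℤ → G i) (i : ℕ) : Wd → ℤ → ℤ → G i
  | [], _, _ => 1
  | (x, b) :: w, m, k =>
    (if x = 1 then cc y i (m + kk w) (k + EE w (1 - m)) ^ sg b else 1) * UU y i w m k

lemma rho_cons (y : ∀ i, ℤ → G i) (x : Fin 2) (b : Bool) (w : Wd) :
    rho y (FreeGroup.mk ((x, b) :: w)) =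
      (cond b (gens y x) (gens y x)⁻¹) * rho y (FreeGroup.mk w) := by
  simp [rho]

lemma rho_apply (y : ∀ i, ℤ → G i) (i : ℕ) (w : Wd) (m k : ℤ) (g : G i) :
    rho y (FreeGroup.mk w) i (m, k, g) = (m + kk w, k + EE w (1 - m), UU y i w m k * g) := by
  induction w with
  | nil => simp [rho, kk, EE, UU]
  | cons a w ih =>
    obtain ⟨x, b⟩ := a
    rw [rho_cons, Pi.mul_apply, Perm.mul_apply, ih]
    have key : m + kk w = 1 ↔ kk w = 1 - m := by constructor <;> intro h <;> linarith
    fin_cases x <;> cases b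
    · simp [gens, SS_inv_apply, kk, EE, UU, sg]; ring
    · simp [gens, SS_apply, kk, EE, UU, sg]; ring
    · simp [gens, TT_inv_apply, kk, EE, UU, sg, key, mul_assoc]
      split_ifs <;> ring
    · simp [gens, TT_apply, kk, EE, UU, sg, key, mul_assoc]
      split_ifs <;> ring

lemma abs_sg (b : Bool) : |sg b| = 1 := by cases b <;> simp [sg]

lemma abs_kk (w : Wd) : |kk w| ≤ w.length := by
  induction w with
  | nil => simp [kk]
  | cons a w ih =>
    obtain ⟨x, b⟩ := a
    simp only [kk, List.length_cons]; push_cast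
    have := abs_sg b
    split_ifs
    · linarith [abs_add_le (kk w) (sg b)]
    · simp; linarith

lemma abs_EE (w : Wd) (c : ℤ) : |EE w c| ≤ w.length := by
  induction w with
  | nil => simp [EE]
  | cons a w ih =>
    obtain ⟨x, b⟩ := a
    simp only [EE, List.length_cons]; push_cast
    have := abs_sg b
    split_ifs
    · linarith [abs_add_le (EE w c) (sg b)]
    · simp; linarith

lemma EE_far (w : Wd) (c : ℤ) (h : (w.length : ℤ) < |c|) : EE w c = 0 := by
  induction w with
  | nil => simp [EE]
  | cons a w ih =>
    obtain ⟨x, b⟩ := a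
    simp only [List.length_cons] at h; push_cast at h
    simp only [EE]
    rw [ih (by linarith), if_neg, add_zero]
    rintro ⟨-, rfl⟩
    linarith [abs_kk w]

lemma UU_triv (y : ∀ i, ℤ → G i) (i : ℕ) (w : Wd) (m k : ℤ)
    (h : ∀ c : ℤ, |c| ≤ w.length → yy y i (m + c) = 1) : UU y i w m k = 1 := by
  induction w with
  | nil => simp [UU]
  | cons a w ih =>
    obtain ⟨x, b⟩ := a
    simp only [List.length_cons] at h; push_cast at h
    have h1 := h (kk w) (by linarith [abs_kk w])
    simp only [UU]
    rw [ih fun c hc => h c (by linarith)]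
    simp [cc, h1]

lemma UU_single (y : ∀ i, ℤ → G i) (i : ℕ) (w : Wd) (m k c0 : ℤ)
    (h : ∀ c : ℤ, |c| ≤ w.length → c ≠ c0 → yy y i (m + c) = 1)
    (h1 : ∀ c : ℤ, |c| ≤ w.length → m + c ≠ 1) :
    UU y i w m k = cc y i (m + c0) k ^ EE w c0 := by
  induction w with
  | nil => simp [UU, EE]
  | cons a w ih =>
    obtain ⟨x, b⟩ := a
    simp only [List.length_cons] at h h1; push_cast at h h1
    have hk := abs_kk w
    have hE : EE w (1 - m) = 0 := by
      apply EE_far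
      by_contra hc
      exact h1 (1 - m) (by linarith) (by ring)
    simp only [UU, EE, hE, add_zero]
    rw [ih (fun c hc => h c (by linarith)) (fun c hc => h1 c (by linarith))]
    by_cases hx : x = 1
    · by_cases hc : kk w = c0
      · simp [hx, hc, ← zpow_add, add_comm (sg b)]
      · have := h (kk w) (by linarith) hc
        simp [hx, hc, cc, this]
    · simp [hx]

lemma UU_pos (y : ∀ i, ℤ → G i) (i : ℕ) (w : Wd) (m k k' : ℤ)
    (h : w.length ≤ k) (h' : w.length ≤ k') : UU y i w m k = UU y i w m k' := by
  induction w with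
  | nil => simp [UU]
  | cons a w ih =>
    obtain ⟨x, b⟩ := a
    simp only [List.length_cons] at h h'; push_cast at h h'
    have hE := abs_le.1 (abs_EE w (1 - m))
    simp only [UU, cc]
    rw [ih (by linarith) (by linarith), if_pos (by linarith : 0 ≤ k + EE w (1 - m)),
      if_pos (by linarith : 0 ≤ k' + EE w (1 - m))]

lemma UU_neg (y : ∀ i, ℤ → G i) (i : ℕ) (w : Wd) (m k : ℤ)
    (h : k < - (w.length : ℤ)) : UU y i w m k = 1 := by
  induction w with
  | nil => simp [UU]
  | cons a w ih =>
    obtain ⟨x, b⟩ := a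
    simp only [List.length_cons] at h; push_cast at h
    have hE := abs_le.1 (abs_EE w (1 - m))
    simp only [UU, cc]
    rw [ih (by linarith), if_neg (by linarith : ¬ 0 ≤ k + EE w (1 - m))]
    simp

lemma pow_gap {a b : ℕ} {L : ℤ} (h : |(2 : ℤ) ^ a - 2 ^ b| ≤ 2 * L) (hL : 4 * L < 2 ^ a) :
    a = b := by
  obtain ⟨h1, h2⟩ := abs_le.1 h
  rcases lt_trichotomy a b with hab | hab | hab
  · have : (2 : ℤ) ^ (a + 1) ≤ 2 ^ b := pow_le_pow_right₀ (by norm_num) hab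
    rw [pow_succ] at this
    have : (0 : ℤ) < 2 ^ a := by positivity
    linarith
  · exact hab
  · have : (2 : ℤ) ^ (b + 1) ≤ 2 ^ a := pow_le_pow_right₀ (by norm_num) hab
    rw [pow_succ] at this
    linarith

lemma rho_eq_one (y : ∀ i, ℤ → G i)
    (hy : ∀ i m, yy y i m ≠ 1 → ∃ j : ℕ, m = 2 ^ j ∧ i < j) (w : Wd)
    (hbox : ∀ (m k : ℤ) (i : ℕ), |m| ≤ 5 * w.length + 2 → |k| ≤ 5 * w.length + 2 →
      i ≤ 5 * w.length + 2 → rho y (FreeGroup.mk w) i (m, k, 1) = (m, k, 1)) :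
    rho y (FreeGroup.mk w) = 1 := by
  have hLn : (0 : ℤ) ≤ w.length := by positivity
  have hk : kk w = 0 := by
    have := hbox 0 0 0 (by simp; positivity) (by simp; positivity) (by positivity)
    rw [rho_apply] at this
    simpa using congrArg Prod.fst this
  have hE : ∀ c, EE w c = 0 := by
    intro c
    rcases lt_or_ge (w.length : ℤ) |c| with h | h
    · exact EE_far w c h
    · have h2 := abs_le.1 h
      have := hbox (1 - c) 0 0 (by rw [abs_le]; constructor <;> linarith)
        (by simp; positivity) (by positivity)
      rw [rho_apply] at this
      simpa using congrArg (fun p => p.2.1) this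
  funext i
  ext1 p
  obtain ⟨m, k, g⟩ := p
  rw [rho_apply, hk, hE]
  simp only [add_zero, Pi.one_apply, Perm.one_apply, Prod.mk.injEq, true_and, mul_eq_right]
  by_cases htriv : ∀ c : ℤ, |c| ≤ w.length → yy y i (m + c) = 1
  · exact UU_triv y i w m k htriv
  push Not at htriv
  obtain ⟨c0, hc0, hne⟩ := htriv
  obtain ⟨j, hj, hij⟩ := hy _ _ hne
  have hc0' := abs_le.1 hc0
  by_cases hbig : (4 * w.length + 1 : ℤ) < 2 ^ j
  · rw [UU_single y i w m k c0, hE, zpow_zero]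
    · intro c hc hcc
      by_contra hcn
      obtain ⟨j', hj', -⟩ := hy _ _ hcn
      have hc' := abs_le.1 hc
      have : j = j' := by
        apply pow_gap (L := w.length)
        · rw [← hj, ← hj', abs_le]; constructor <;> linarith
        · linarith
      subst this
      apply hcc; linarith
    · intro c hc hcn
      have hc' := abs_le.1 hc
      have : j = 0 := by
        apply pow_gap (L := w.length)
        · rw [← hj, pow_zero, ← hcn, abs_le]; constructor <;> linarith
        · linarith
      subst this
      simp at hbig
      linarith
  · push Not at hbig
    have hi : (i : ℤ) ≤ 4 * w.length + 1 := by
      have : i < 2 ^ j := lt_trans hij Nat.lt_two_pow_self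
      have : (i : ℤ) < 2 ^ j := by exact_mod_cast this
      linarith
    have hpos : (0 : ℤ) < 2 ^ j := by positivity
    have hm : |m| ≤ 5 * w.length + 2 := by
      rw [abs_le]; constructor <;> linarith
    have hi' : i ≤ 5 * w.length + 2 := by
      zify; linarith
    have hin : ∀ k : ℤ, |k| ≤ w.length → UU y i w m k = 1 := by
      intro k hk'
      have := hbox m k i hm (by linarith) hi'
      rw [rho_apply] at this
      simpa using congrArg (fun p => p.2.2) this
    rcases lt_or_ge k (-(w.length : ℤ)) with h1 | h1
    · exact UU_neg y i w m k h1
    rcases lt_or_ge k (w.length : ℤ) with h2 | h2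
    · exact hin k (by rw [abs_le]; constructor <;> linarith)
    · rw [UU_pos y i w m k w.length h2 le_rfl]
      exact hin _ (by simp)

end

section
variable {G : ℕ → Type} [∀ i, Group (G i)]

/-- The embedding of `G i` at the origin. -/
def dl (i : ℕ) : G i →* Perm (ℤ × ℤ × G i) where
  toFun g :=
    { toFun := fun p => (p.1, p.2.1, if p.1 = 0 ∧ p.2.1 = 0 then g * p.2.2 else p.2.2)
      invFun := fun p => (p.1, p.2.1, if p.1 = 0 ∧ p.2.1 = 0 then g⁻¹ * p.2.2 else p.2.2)
      left_inv := fun p => by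
        obtain ⟨a, b, h⟩ := p
        by_cases hh : a = 0 ∧ b = 0 <;> simp [hh]
      right_inv := fun p => by
        obtain ⟨a, b, h⟩ := p
        by_cases hh : a = 0 ∧ b = 0 <;> simp [hh] }
  map_one' := by ext1 p; simp
  map_mul' g g' := by
    ext1 ⟨a, b, h⟩
    by_cases hh : a = 0 ∧ b = 0 <;> simp [hh, mul_assoc]

lemma dl_apply (i : ℕ) (g h : G i) (m k : ℤ) :
    dl i g (m, k, h) = (m, k, if m = 0 ∧ k = 0 then g * h else h) := rfl

def dlt (i : ℕ) : G i →* Amb G :=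
  (MonoidHom.mulSingle (fun i => Perm (ℤ × ℤ × G i)) i).comp (dl i)

lemma dlt_same (i : ℕ) (g : G i) : dlt i g i = dl i g := by simp [dlt]

lemma dlt_ne (i i' : ℕ) (h : i' ≠ i) (g : G i) : dlt i g i' = 1 := by
  simp [dlt, Pi.mulSingle_eq_of_ne h]

lemma SS_pow (i n : ℕ) (m k : ℤ) (g : G i) :
    ((SS (G := G) i) ^ n) (m, k, g) = (m + n, k, g) := by
  induction n with
  | zero => simp
  | succ n ih => rw [pow_succ', Perm.mul_apply, ih, SS_apply]; push_cast; simp [add_assoc]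

lemma SS_pow_inv (i n : ℕ) (m k : ℤ) (g : G i) :
    ((SS (G := G) i) ^ n)⁻¹ (m, k, g) = (m - n, k, g) := by
  rw [Perm.inv_eq_iff_eq, SS_pow]; simp

lemma dlt_mem (y : ∀ i, ℤ → G i)
    (hy : ∀ i m, yy y i m ≠ 1 → ∃ j : ℕ, m = 2 ^ j ∧ i < j) (i j : ℕ) (hj : 1 ≤ j)
    (hne : ∀ i', i' ≠ i → yy y i' (2 ^ j) = 1) :
    dlt i (yy y i (2 ^ j)) ∈ (rho y).range := by
  have hS : (SS : Amb G) ∈ (rho y).range := ⟨FreeGroup.of 0, by simp [rho, gens]⟩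
  have hT : TT y ∈ (rho y).range := ⟨FreeGroup.of 1, by simp [rho, gens]⟩
  obtain ⟨n, hn⟩ : ∃ n : ℕ, n + 1 = 2 ^ j := ⟨2 ^ j - 1, Nat.sub_add_cancel Nat.one_le_two_pow⟩
  have hn' : ((2 : ℤ) ^ j) = n + 1 := by exact_mod_cast hn.symm
  have hev : ∃ q : ℤ, (n : ℤ) + 1 = 2 * q := by
    refine ⟨2 ^ (j - 1), ?_⟩
    rw [← hn', ← pow_succ', Nat.sub_add_cancel hj]
  have hn1 : n ≠ 0 := by
    rintro rfl
    obtain ⟨q, hq⟩ := hev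
    simp at hq; omega
  have key : dlt i (yy y i (2 ^ j)) = (SS ^ (n + 1))⁻¹ * (TT y * (SS ^ n * TT y * (SS ^ n)⁻¹) *
      (TT y)⁻¹ * (SS ^ n * (TT y)⁻¹ * (SS ^ n)⁻¹)) * SS ^ (n + 1) := by
    have hU : ∀ i', ∀ (m k : ℤ) (g : G i'), ((SS ^ n * TT y * (SS ^ n)⁻¹ : Amb G) i') (m, k, g) =
        (m, (if m - n = 1 then k + 1 else k), cc y i' (m - n) k * g) := by
      intro i' m k g
      simp only [Pi.mul_apply, Pi.pow_apply, Pi.inv_apply, Perm.mul_apply, SS_pow, SS_pow_inv,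
        TT_apply, sub_add_cancel]
    have hV : ∀ i', ∀ (m k : ℤ) (g : G i'),
        ((SS ^ n * (TT y)⁻¹ * (SS ^ n)⁻¹ : Amb G) i') (m, k, g) =
        (m, (if m - n = 1 then k - 1 else k), (cc y i' (m - n) k)⁻¹ * g) := by
      intro i' m k g
      simp only [Pi.mul_apply, Pi.pow_apply, Pi.inv_apply, Perm.mul_apply, SS_pow, SS_pow_inv,
        TT_inv_apply, sub_add_cancel]
    have hcom : ∀ i', ∀ (m k : ℤ) (g : G i'), ((TT y * (SS ^ n * TT y * (SS ^ n)⁻¹) *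
        (TT y)⁻¹ * (SS ^ n * (TT y)⁻¹ * (SS ^ n)⁻¹) : Amb G) i') (m, k, g) =
        (m, k, if m = 2 ^ j ∧ k = 0 then yy y i' (2 ^ j) * g else g) := by
      intro i' m k g
      rw [Pi.mul_apply, Pi.mul_apply, Pi.mul_apply, Perm.mul_apply, Perm.mul_apply,
        Perm.mul_apply, hV, Pi.inv_apply, TT_inv_apply, hU, TT_apply]
      by_cases hm : m - n = 1
      · have hm1 : m ≠ 1 := by omega
        have hmj : m = 2 ^ j := by omega
        rw [hm]
        simp only [cc_one, hm1, if_true, if_false, inv_one, one_mul, sub_add_cancel]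
        rw [hmj]
        refine Prod.ext rfl (Prod.ext rfl ?_)
        simp only [cc, true_and]
        rcases lt_trichotomy k 0 with h | h | h
        · rw [if_neg (by omega), if_neg (by omega), if_neg (by omega)]; simp
        · subst h; simp
        · rw [if_pos (by omega), if_pos (by omega), if_neg (by omega)]; simp
      · have hmj : ¬ (m = 2 ^ j ∧ k = 0) := by omega
        simp only [hm, if_false, hmj]
        by_cases hm1 : m = 1
        · have e4 : ∀ k, cc y i' (m - n) k = 1 := by
            intro k
            simp only [cc, yy]; rw [if_neg (by omega : ¬ 2 ≤ m - n)]; simp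
          simp only [e4]
          rw [hm1]
          simp [cc_one]
        · simp only [hm1, if_false]
          refine Prod.ext rfl (Prod.ext rfl ?_)
          by_cases ha : yy y i' m = 1
          · simp [cc, ha]
          by_cases hb : yy y i' (m - n) = 1
          · simp [cc, hb]
          exfalso
          obtain ⟨a, ha, ha'⟩ := hy _ _ ha
          obtain ⟨b, hb, hb'⟩ := hy _ _ hb
          obtain ⟨q, hq⟩ := hev
          obtain ⟨a, rfl⟩ : ∃ a', a = a' + 1 := ⟨a - 1, by omega⟩
          obtain ⟨b, rfl⟩ : ∃ b', b = b' + 1 := ⟨b - 1, by omega⟩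
          rw [pow_succ] at ha hb
          omega
    have main : ∀ i', ∀ (m k : ℤ) (g : G i'), (((SS ^ (n + 1))⁻¹ * (TT y * (SS ^ n * TT y * (SS ^ n)⁻¹) *
      (TT y)⁻¹ * (SS ^ n * (TT y)⁻¹ * (SS ^ n)⁻¹)) * SS ^ (n + 1) : Amb G) i') (m, k, g) =
        (m, k, if m = 0 ∧ k = 0 then yy y i' (2 ^ j) * g else g) := by
      intro i' m k g
      rw [Pi.mul_apply, Pi.mul_apply, Perm.mul_apply, Perm.mul_apply, Pi.pow_apply, SS_pow, hcom,
        Pi.inv_apply, Pi.pow_apply, SS_pow_inv]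
      have e : (m + ((n + 1 : ℕ) : ℤ) = 2 ^ j) ↔ m = 0 := by
        push_cast; constructor <;> intro h <;> linarith
      simp only [e, add_sub_cancel_right]
    funext i'
    ext1 ⟨m, k, g⟩
    rw [main]
    by_cases h : i' = i
    · subst h; rw [dlt_same, dl_apply]
    · rw [dlt_ne _ _ h, hne _ h]; simp
  rw [key]
  have hS' := fun n => (rho y).range.pow_mem hS n
  have hi := fun {x} => (rho y).range.inv_mem (x := x)
  have hm := fun {x z} => (rho y).range.mul_mem (x := x) (y := z)
  exact hm (hm (hi (hS' _)) (hm (hm (hm hT (hm (hm (hS' _) hT) (hi (hS' _)))) (hi hT))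
    (hm (hm (hS' _) (hi hT)) (hi (hS' _))))) (hS' _)

lemma exists_word (y : ∀ i, ℤ → G i) (h : (rho y).range) :
    ∃ w : Wd, h.1 = rho y (FreeGroup.mk w) := by
  obtain ⟨h, f, rfl⟩ := h
  exact ⟨f.toWord, by simp [FreeGroup.mk_toWord]⟩

lemma frattini (y : ∀ i, ℤ → G i) (i : ℕ) (hmem : ∀ g, dlt i g ∈ (rho y).range) :
    IsFrattini ((dlt i).codRestrict (rho y).range hmem) := by
  constructor
  · intro a b hab
    have h1 : dlt i a = dlt i b := congrArg Subtype.val hab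
    have h2 : dl i a (0, 0, 1) = dl i b (0, 0, 1) := by rw [← dlt_same, h1, dlt_same]
    simpa [dl_apply] using h2
  · intro a b
    constructor
    · intro h; exact MonoidHom.map_isConj _ h
    · intro h
      rw [isConj_iff] at h
      obtain ⟨c, hc⟩ := h
      obtain ⟨w, hw⟩ := exists_word y c
      have hc' : c.1 * dlt i a = dlt i b * c.1 := by
        have := congrArg Subtype.val (mul_inv_eq_iff_eq_mul.1 hc)
        simpa using this
      by_cases ha : a = 1
      · subst ha
        have : dlt i b = 1 := by simpa using hc'.symm
        have h2 : dl i b (0, 0, 1) = (0, 0, 1) := by rw [← dlt_same, this]; rfl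
        have : b = 1 := by simpa [dl_apply] using h2
        rw [this]
      · have h3 := congrFun hc' i
        have h4 := congrArg (fun p : Perm _ => p (0, 0, 1)) h3
        simp only [Pi.mul_apply, Perm.mul_apply, dlt_same, dl_apply, hw, rho_apply] at h4
        simp only [and_self, if_true, mul_one, Prod.mk.injEq, true_and] at h4
        split_ifs at h4 with h5
        · rw [isConj_iff]
          exact ⟨UU y i w 0 0, by rw [h4]; group⟩
        · exact absurd (mul_eq_left.1 h4) ha

end

section wl
variable {A B : Type*} [Group A] [Group B]

lemma wl_le (X : Finset A) (w : List A) (hw : ∀ a ∈ w, a ∈ X ∨ a⁻¹ ∈ X) :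
    wordLength X w.prod ≤ w.length :=
  Nat.sInf_le ⟨w, rfl, hw, rfl⟩

lemma wl_spec (X : Finset A) (hX : Generates X) (g : A) :
    ∃ w : List A, w.length = wordLength X g ∧ (∀ a ∈ w, a ∈ X ∨ a⁻¹ ∈ X) ∧ w.prod = g := by
  have : g ∈ Subgroup.closure (X : Set A) := by
    have h : Subgroup.closure (X : Set A) = ⊤ := hX
    rw [h]; trivial
  rw [← Subgroup.mem_toSubmonoid, Subgroup.closure_toSubmonoid] at this
  obtain ⟨w, hw, hp⟩ := Submonoid.exists_list_of_mem_closure this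
  exact Nat.sInf_mem (s := {n | ∃ w : List A, w.length = n ∧ (∀ a ∈ w, a ∈ X ∨ a⁻¹ ∈ X) ∧ w.prod = g})
    ⟨w.length, w, rfl, hw, hp⟩

lemma wl_one (X : Finset A) : wordLength X (1 : A) = 0 :=
  Nat.le_zero.1 (wl_le X [] (by simp))

lemma wl_mul (X : Finset A) (hX : Generates X) (g h : A) :
    wordLength X (g * h) ≤ wordLength X g + wordLength X h := by
  obtain ⟨w, h1, h2, h3⟩ := wl_spec X hX g
  obtain ⟨w', h1', h2', h3'⟩ := wl_spec X hX h
  have := wl_le X (w ++ w') (by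
    intro a ha
    rcases List.mem_append.1 ha with h | h
    · exact h2 a h
    · exact h2' a h)
  simpa [h1, h1', h3, h3'] using this

lemma wl_inv (X : Finset A) (hX : Generates X) (g : A) :
    wordLength X g⁻¹ ≤ wordLength X g := by
  obtain ⟨w, h1, h2, h3⟩ := wl_spec X hX g
  have := wl_le X (w.map (·⁻¹)).reverse (by
    intro a ha
    simp only [List.mem_reverse, List.mem_map] at ha
    obtain ⟨b, hb, rfl⟩ := ha
    rcases h2 b hb with h | h
    · right; simpa using h
    · left; exact h)
  rw [← List.prod_inv_reverse, h3] at this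
  simpa [h1] using this

lemma wl_gen (X : Finset A) (a : A) (ha : a ∈ X) : wordLength X a ≤ 1 := by
  have := wl_le X [a] (by simp [ha])
  simpa using this

lemma wl_lip (X : Finset A) (Y : Finset B) (hX : Generates X) (hY : Generates Y) (φ : A →* B) :
    ∃ C : ℕ, ∀ g, wordLength Y (φ g) ≤ C * wordLength X g := by
  refine ⟨X.sup fun x => wordLength Y (φ x), fun g => ?_⟩
  obtain ⟨w, h1, h2, rfl⟩ := wl_spec X hX g
  rw [← h1]
  clear h1
  induction w with
  | nil => simp [wl_one]
  | cons a w ih =>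
    have ih := ih fun b hb => h2 b (List.mem_cons_of_mem _ hb)
    have ha : wordLength Y (φ a) ≤ X.sup fun x => wordLength Y (φ x) := by
      rcases h2 a List.mem_cons_self with h | h
      · exact Finset.le_sup (f := fun x => wordLength Y (φ x)) h
      · have h3 := Finset.le_sup (f := fun x => wordLength Y (φ x)) h
        have h4 := wl_inv Y hY (φ a⁻¹)
        rw [map_inv, inv_inv, ← map_inv] at h4
        exact h4.trans h3
    rw [List.prod_cons, map_mul, List.length_cons]
    calc _ ≤ _ := wl_mul Y hY _ _
      _ ≤ _ := Nat.add_le_add ha ih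
      _ = _ := by ring

open Classical in
/-- Generating set coming from a surjection. -/
noncomputable def gset {m : ℕ} (f : FreeGroup (Fin m) →* A) : Finset A :=
  Finset.univ.image fun a => f (FreeGroup.of a)

lemma gset_mem {m : ℕ} (f : FreeGroup (Fin m) →* A) (a : A) :
    a ∈ gset f ↔ ∃ x, f (FreeGroup.of x) = a := by
  simp [gset]

lemma gset_gen {m : ℕ} (f : FreeGroup (Fin m) →* A) (hf : Function.Surjective f) :
    Generates (gset f) := by
  unfold Generates
  have : (gset f : Set A) = f '' Set.range FreeGroup.of := by
    ext a; simp [gset]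
  rw [this, ← MonoidHom.map_closure, FreeGroup.closure_range_of, ← MonoidHom.range_eq_map,
    MonoidHom.range_eq_top.2 hf]

end wl

section
variable {G : ℕ → Type} [∀ i, Group (G i)]

lemma UU_len (y : ∀ i, ℤ → G i) (i : ℕ) (X : Finset (G i)) (hX : Generates X)
    (hyX : ∀ m, yy y i m = 1 ∨ yy y i m ∈ X) (w : Wd) (m k : ℤ) :
    wordLength X (UU y i w m k) ≤ w.length := by
  induction w with
  | nil => simp [UU, wl_one]
  | cons a w ih =>
    obtain ⟨x, b⟩ := a
    have hc : ∀ m k, wordLength X (cc y i m k) ≤ 1 := by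
      intro m k
      simp only [cc]
      split_ifs
      · rcases hyX m with h | h
        · rw [h, wl_one]; omega
        · exact wl_gen _ _ h
      · rw [wl_one]; omega
    simp only [UU, List.length_cons]
    refine (wl_mul X hX _ _).trans ?_
    rw [add_comm]
    refine Nat.add_le_add ih ?_
    split_ifs
    · cases b
      · simp only [sg, Bool.false_eq_true, if_false, zpow_neg, zpow_one]
        exact (wl_inv X hX _).trans (hc _ _)
      · simpa [sg] using hc _ _
    · rw [wl_one]; omega

lemma qi (y : ∀ i, ℤ → G i) (i : ℕ) (X : Finset (G i)) (hX : Generates X)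
    (hyX : ∀ m, yy y i m = 1 ∨ yy y i m ∈ X) (hmem : ∀ g, dlt i g ∈ (rho y).range) :
    IsQIEmbedding X (gset (rho y).rangeRestrict) ((dlt i).codRestrict (rho y).range hmem) := by
  refine ⟨(frattini y i hmem).1, ?_⟩
  have hY := gset_gen (rho y).rangeRestrict (rho y).rangeRestrict_surjective
  obtain ⟨C, hC⟩ := wl_lip X _ hX hY ((dlt i).codRestrict (rho y).range hmem)
  have hlow : ∀ g, wordLength X g ≤
      wordLength (gset (rho y).rangeRestrict) ((dlt i).codRestrict (rho y).range hmem g) := by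
    intro g
    obtain ⟨v, h1, h2, h3⟩ := wl_spec _ hY ((dlt i).codRestrict (rho y).range hmem g)
    obtain ⟨w, hw, hw'⟩ : ∃ w : Wd, w.length = v.length ∧
        rho y (FreeGroup.mk w) = (v.prod).1 := by
      clear h1 h3
      induction v with
      | nil => exact ⟨[], rfl, by rw [List.prod_nil]; simp [rho]⟩
      | cons a v ih =>
        obtain ⟨w, hw, hw'⟩ := ih fun b hb => h2 b (List.mem_cons_of_mem _ hb)
        rcases h2 a List.mem_cons_self with h | h
        · obtain ⟨x, hx⟩ := (gset_mem _ _).1 h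
          refine ⟨(x, true) :: w, by simp [hw], ?_⟩
          rw [rho_cons, hw', List.prod_cons, ← hx]
          have : gens y x = rho y (FreeGroup.of x) := by simp [rho]
          rw [this]; rfl
        · obtain ⟨x, hx⟩ := (gset_mem _ _).1 h
          refine ⟨(x, false) :: w, by simp [hw], ?_⟩
          rw [rho_cons, hw', List.prod_cons, ← inv_inv a, ← hx]
          have : gens y x = rho y (FreeGroup.of x) := by simp [rho]
          rw [this]; rfl
    rw [← h1, ← hw]
    have h4 : rho y (FreeGroup.mk w) i (0, 0, 1) = dl i g (0, 0, 1) := by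
      rw [hw', h3, ← dlt_same]; rfl
    rw [rho_apply, dl_apply] at h4
    have h5 : UU y i w 0 0 = g := by simpa using congrArg (fun p => p.2.2) h4
    rw [← h5]
    exact UU_len y i X hX hyX w 0 0
  refine ⟨C + 1, 1, by positivity, one_pos, fun g => ⟨?_, ?_⟩⟩
  · have h1 : (wordLength X g : ℝ) ≤ _ := Nat.cast_le.2 (hlow g)
    have h2 : 1 / ((C : ℝ) + 1) * (wordLength X g : ℝ) ≤ wordLength X g := by
      rw [one_div_mul_eq_div]
      apply div_le_self (by positivity)
      have : (0 : ℝ) ≤ C := by positivity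
      linarith
    linarith
  · have h1 : (_ : ℝ) ≤ ((C * wordLength X g : ℕ) : ℝ) := Nat.cast_le.2 (hC g)
    push_cast at h1
    have : (0 : ℝ) ≤ wordLength X g := by positivity
    linarith

end

section comp

def lab (d : ℕ) : ℕ := Nat.findGreatest (fun j => 2 ^ j = d) d

def okp (i ni d : ℕ) : Prop :=
  2 ^ (lab d) = d ∧ 1 ≤ lab d ∧ (lab d - 1).unpair.1 = i ∧ (lab d - 1).unpair.2 < ni

instance (i ni d : ℕ) : Decidable (okp i ni d) := by unfold okp; infer_instance

lemma lab_pow (j : ℕ) : lab (2 ^ j) = j := by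
  have h := Nat.findGreatest_spec (P := fun j' => 2 ^ j' = 2 ^ j) (n := 2 ^ j)
    (Nat.lt_two_pow_self.le : j ≤ 2 ^ j) rfl
  exact Nat.pow_right_injective le_rfl h

abbrev St := ((ℕ × ℕ) × (ℕ × ℕ)) × List (ℕ × Bool)

def step (q : ℕ × ℕ) (x : Fin 2 × Bool) (s : St) : St :=
  if x.1 = 0 then
    (if x.2 = true then (((s.1.1.1 + 1, s.1.1.2), s.1.2), s.2)
      else (((s.1.1.1, s.1.1.2 + 1), s.1.2), s.2))
  else
    ((s.1.1, if s.1.1.1 = s.1.1.2 + 1 then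
        (if x.2 = true then (s.1.2.1 + 1, s.1.2.2) else (s.1.2.1, s.1.2.2 + 1)) else s.1.2),
      if s.1.2.2 ≤ s.1.2.1 ∧ okp q.1 q.2 (s.1.1.1 - s.1.1.2) then
        ((lab (s.1.1.1 - s.1.1.2) - 1).unpair.2, x.2) :: s.2 else s.2)

def runw (q : ℕ × ℕ) (w : Wd) (s : St) : St := w.foldr (step q) s

def pre (s0 s : St) : Option ℤ :=
  if s.1.1.1 + s0.1.1.2 < s0.1.1.1 + s.1.1.2 then some (-1)
  else if s0.1.1.1 + s.1.1.2 < s.1.1.1 + s0.1.1.2 then some 1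
  else if s.1.2.1 + s0.1.2.2 < s0.1.2.1 + s.1.2.2 then some (-1)
  else if s0.1.2.1 + s.1.2.2 < s.1.2.1 + s0.1.2.2 then some 1
  else none

def st0 (t : ℕ) : St :=
  ((t.unpair.1.unpair.1.unpair, t.unpair.1.unpair.2.unpair), [])

def ix (t : ℕ) : ℕ := t.unpair.2

def sgnAt (n : ℕ → ℕ) (F : ℕ × List (ℕ × Bool) → ℤ) (w : Wd) (t : ℕ) : ℤ :=
  (pre (st0 t) (runw (ix t, n (ix t)) w (st0 t))).getD
    (F (ix t, (runw (ix t, n (ix t)) w (st0 t)).2))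

def FN (s : ℕ → ℤ) : ℕ → ℤ
  | 0 => 0
  | t + 1 => if FN s t = 0 then s t else FN s t

lemma FN_zero (s : ℕ → ℤ) (B : ℕ) (h : FN s B = 0) : ∀ t < B, s t = 0 := by
  induction B with
  | zero => intro t ht; omega
  | succ B ih =>
    simp only [FN] at h
    by_cases h0 : FN s B = 0
    · rw [if_pos h0] at h
      intro t ht
      rcases Nat.lt_succ_iff_lt_or_eq.1 ht with h1 | rfl
      · exact ih h0 t h1
      · exact h
    · rw [if_neg h0] at h
      exact absurd h h0

lemma FN_ne (s : ℕ → ℤ) (B : ℕ) (h : FN s B ≠ 0) :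
    ∃ t < B, (∀ j < t, s j = 0) ∧ s t = FN s B := by
  induction B with
  | zero => simp [FN] at h
  | succ B ih =>
    simp only [FN] at h ⊢
    split_ifs at h ⊢ with h0
    · exact ⟨B, by omega, FN_zero s B h0, rfl⟩
    · obtain ⟨t, h1, h2⟩ := ih h0
      exact ⟨t, by omega, h2⟩

def bnd (w : Wd) : ℕ := (5 * w.length + 3) ^ 8

lemma prim_pow : Primrec₂ ((· ^ ·) : ℕ → ℕ → ℕ) := Primrec₂.unpaired'.1 Nat.Primrec.pow

lemma prim_lab : Primrec lab := by
  apply Primrec.nat_findGreatest Primrec.id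
  exact Primrec.eq.comp₂ (prim_pow.comp₂ (Primrec₂.const 2) Primrec₂.right) Primrec₂.left

lemma prim_okp : PrimrecPred fun p : ℕ × ℕ × ℕ => okp p.1 p.2.1 p.2.2 := by
  have hd : Primrec fun p : ℕ × ℕ × ℕ => p.2.2 := Primrec.snd.comp Primrec.snd
  have hl : Primrec fun p : ℕ × ℕ × ℕ => lab p.2.2 := prim_lab.comp hd
  have hu : Primrec fun p : ℕ × ℕ × ℕ => (lab p.2.2 - 1).unpair :=
    Primrec.unpair.comp (Primrec.nat_sub.comp hl (Primrec.const 1))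
  exact (Primrec.eq.comp (prim_pow.comp (Primrec.const 2) hl) hd).and
    ((Primrec.nat_le.comp (Primrec.const 1) hl).and
      ((Primrec.eq.comp (Primrec.fst.comp hu) Primrec.fst).and
        (Primrec.nat_lt.comp (Primrec.snd.comp hu) (Primrec.fst.comp Primrec.snd))))

lemma prim_step : Primrec fun p : (ℕ × ℕ) × (Fin 2 × Bool) × St => step p.1 p.2.1 p.2.2 := by
  have q1 : Primrec fun p : (ℕ × ℕ) × (Fin 2 × Bool) × St => p.1.1 := Primrec.fst.comp Primrec.fst
  have q2 : Primrec fun p : (ℕ × ℕ) × (Fin 2 × Bool) × St => p.1.2 := Primrec.snd.comp Primrec.fst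
  have hx : Primrec fun p : (ℕ × ℕ) × (Fin 2 × Bool) × St => p.2.1 := Primrec.fst.comp Primrec.snd
  have hs : Primrec fun p : (ℕ × ℕ) × (Fin 2 × Bool) × St => p.2.2 := Primrec.snd.comp Primrec.snd
  have x1 := Primrec.fst.comp hx
  have x2 := Primrec.snd.comp hx
  have s1 := Primrec.fst.comp hs
  have wd := Primrec.snd.comp hs
  have m := Primrec.fst.comp s1
  have k := Primrec.snd.comp s1
  have a2 := Primrec.fst.comp m
  have b2 := Primrec.snd.comp m
  have a1 := Primrec.fst.comp k
  have b1 := Primrec.snd.comp k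
  have d := Primrec.nat_sub.comp a2 b2
  have hb := Primrec.eq.comp x2 (Primrec.const true)
  have one := fun {f : (ℕ × ℕ) × (Fin 2 × Bool) × St → ℕ} (hf : Primrec f) =>
    Primrec.nat_add.comp hf (Primrec.const 1)
  unfold step
  refine Primrec.ite (Primrec.eq.comp x1 (Primrec.const 0)) ?_ ?_
  · exact Primrec.ite hb (((one a2).pair b2).pair k |>.pair wd)
      ((a2.pair (one b2)).pair k |>.pair wd)
  · refine Primrec.pair (Primrec.pair m ?_) ?_
    · exact Primrec.ite (Primrec.eq.comp a2 (one b2))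
        (Primrec.ite hb ((one a1).pair b1) (a1.pair (one b1))) k
    · refine Primrec.ite ?_ ?_ wd
      · exact (Primrec.nat_le.comp b1 a1).and (prim_okp.comp (q1.pair (q2.pair d)))
      · refine Primrec.list_cons.comp (Primrec.pair (Primrec.snd.comp (Primrec.unpair.comp
          (Primrec.nat_sub.comp (prim_lab.comp d) (Primrec.const 1)))) x2) wd

lemma prim_run : Primrec fun p : (ℕ × ℕ) × Wd × St => runw p.1 p.2.1 p.2.2 := by
  unfold runw
  refine Primrec.list_foldr (h := fun (p : (ℕ × ℕ) × Wd × St) (bs : (Fin 2 × Bool) × St) =>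
    step p.1 bs.1 bs.2) (Primrec.fst.comp Primrec.snd) (Primrec.snd.comp Primrec.snd) ?_
  exact prim_step.comp (Primrec.pair (Primrec.fst.comp Primrec.fst) Primrec.snd)

lemma prim_pre : Primrec fun p : St × St => pre p.1 p.2 := by
  have h1 : Primrec fun p : St × St => p.1.1 := Primrec.fst.comp Primrec.fst
  have h2 : Primrec fun p : St × St => p.2.1 := Primrec.fst.comp Primrec.snd
  have a := Primrec.fst.comp (Primrec.fst.comp h1)
  have b := Primrec.snd.comp (Primrec.fst.comp h1)
  have c := Primrec.fst.comp (Primrec.snd.comp h1)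
  have d := Primrec.snd.comp (Primrec.snd.comp h1)
  have a' := Primrec.fst.comp (Primrec.fst.comp h2)
  have b' := Primrec.snd.comp (Primrec.fst.comp h2)
  have c' := Primrec.fst.comp (Primrec.snd.comp h2)
  have d' := Primrec.snd.comp (Primrec.snd.comp h2)
  unfold pre
  refine Primrec.ite (Primrec.nat_lt.comp (Primrec.nat_add.comp a' b) (Primrec.nat_add.comp a b'))
    (Primrec.const _) ?_
  refine Primrec.ite (Primrec.nat_lt.comp (Primrec.nat_add.comp a b') (Primrec.nat_add.comp a' b))
    (Primrec.const _) ?_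
  refine Primrec.ite (Primrec.nat_lt.comp (Primrec.nat_add.comp c' d) (Primrec.nat_add.comp c d'))
    (Primrec.const _) ?_
  exact Primrec.ite (Primrec.nat_lt.comp (Primrec.nat_add.comp c d') (Primrec.nat_add.comp c' d))
    (Primrec.const _) (Primrec.const _)

lemma prim_st0 : Primrec st0 := by
  have u : Primrec fun t : ℕ => t.unpair.1.unpair :=
    Primrec.unpair.comp (Primrec.fst.comp Primrec.unpair)
  exact Primrec.pair (Primrec.pair (Primrec.unpair.comp (Primrec.fst.comp u))
    (Primrec.unpair.comp (Primrec.snd.comp u))) (Primrec.const [])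

lemma comp_sgn_abs (ix : ℕ → ℕ) (hix : Computable ix) {S : Type} [Primcodable S] {W : Type} [Primcodable W]
   {V Z : Type} [Primcodable V] [Primcodable Z]
   (z : ℕ → S) (hz : Computable z) (R : ℕ × ℕ → W → S → S)
   (hR : Computable fun p : (ℕ × ℕ) × W × S => R p.1 p.2.1 p.2.2)
   (P : S → S → Option Z) (hP : Computable fun p : S × S => P p.1 p.2)
   (pr : S → V) (hpr : Computable pr) (n : ℕ → ℕ) (hn : Computable n)
   (F : ℕ × V → Z) (hF : Computable F) :
   Computable fun p : W × ℕ => (P (z p.2) (R (ix p.2, n (ix p.2)) p.1 (z p.2))).getD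
    (F (ix p.2, pr (R (ix p.2, n (ix p.2)) p.1 (z p.2)))) := by
  have hi : Computable fun p : W × ℕ => ix p.2 := hix.comp Computable.snd
  have h0 : Computable fun p : W × ℕ => z p.2 := hz.comp Computable.snd
  have hq : Computable fun p : W × ℕ => ((ix p.2, n (ix p.2)), p.1, z p.2) :=
    (hi.pair (hn.comp hi)).pair (Computable.fst.pair h0)
  have hr : Computable fun p : W × ℕ => R (ix p.2, n (ix p.2)) p.1 (z p.2) := hR.comp hq
  have hp : Computable fun p : W × ℕ => P (z p.2) (R (ix p.2, n (ix p.2)) p.1 (z p.2)) :=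
    hP.comp (h0.pair hr)
  have hf : Computable fun p : W × ℕ => F (ix p.2, pr (R (ix p.2, n (ix p.2)) p.1 (z p.2))) :=
    hF.comp (hi.pair (hpr.comp hr))
  exact Computable.option_getD hp hf

lemma comp_ix : Computable ix := Computable.snd.comp Computable.unpair

lemma comp_sgnAt (n : ℕ → ℕ) (hn : Computable n) (F : ℕ × List (ℕ × Bool) → ℤ)
    (hF : Computable F) : Computable fun p : Wd × ℕ => sgnAt n F p.1 p.2 := 
  comp_sgn_abs ix comp_ix st0 prim_st0.to_comp runw prim_run.to_comp pre prim_pre.to_comp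
    (fun s : St => s.2) Computable.snd n hn F hF

lemma prim_bnd : Primrec bnd :=
  prim_pow.comp (Primrec.nat_add.comp (Primrec.nat_mul.comp (Primrec.const 5) Primrec.list_length)
    (Primrec.const 3)) (Primrec.const 8)

lemma dec_zero : Computable fun z : ℤ => decide (z = 0) :=
  (PrimrecPred.decide (Primrec.eq.comp Primrec.id (Primrec.const (0 : ℤ)))).to_comp

lemma comp_FN_abs {W Z : Type} [Primcodable W] [Primcodable Z] (z0 : Z) (S : W → ℕ → Z)
   (hs : Computable fun p : W × ℕ => S p.1 p.2) (d : Z → Bool) (hd : Computable d) (b : W → ℕ)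
   (hb : Computable b) : Computable fun w =>
     (Nat.rec z0 (fun t v => cond (d v) (S w t) v) (b w) : Z) := by
  have c1 : Computable fun p : W × (ℕ × Z) => d p.2.2 :=
    hd.comp (Computable.snd.comp Computable.snd)
  have c2 : Computable fun p : W × (ℕ × Z) => S p.1 p.2.1 :=
    hs.comp (Computable.fst.pair (Computable.fst.comp Computable.snd))
  have c3 : Computable fun p : W × (ℕ × Z) => p.2.2 :=
    Computable.snd.comp Computable.snd
  have hst : Computable₂ fun (w : W) (p : ℕ × Z) =>
      cond (d p.2) (S w p.1) p.2 := Computable.cond c1 c2 c3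
  exact Computable.nat_rec hb (Computable.const z0) hst

lemma comp_FN (n : ℕ → ℕ) (hn : Computable n) (F : ℕ × List (ℕ × Bool) → ℤ)
    (hF : Computable F) : Computable fun w : Wd => FN (sgnAt n F w) (bnd w) := by
  have hb : Computable bnd := prim_bnd.to_comp
  have := comp_FN_abs (0 : ℤ) (sgnAt n F) (comp_sgnAt n hn F hF) (fun z => decide (z = 0)) dec_zero bnd hb
  refine this.of_eq ?_
  intro w
  generalize bnd w = B
  induction B with
  | zero => rfl
  | succ B ih =>
    simp only [FN]
    rw [← ih]
    simp only [Bool.cond_decide]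

end comp

section
variable {G : ℕ → Type} [∀ i, Group (G i)]

noncomputable def yv (n : ℕ → ℕ) (π : ∀ i, FreeGroup (Fin (n i)) →* G i) (i : ℕ) (m : ℤ) : G i :=
  if h : okp i (n i) m.toNat then
    π i (FreeGroup.of ⟨(lab m.toNat - 1).unpair.2, h.2.2.2⟩) else 1

lemma okp_two {i ni d : ℕ} (h : okp i ni d) : 2 ≤ d := by
  obtain ⟨h1, h2, -⟩ := h
  rw [← h1]
  calc 2 = 2 ^ 1 := rfl
    _ ≤ _ := Nat.pow_le_pow_right (by norm_num) h2

lemma yy_yv (n : ℕ → ℕ) (π : ∀ i, FreeGroup (Fin (n i)) →* G i) (i : ℕ) (m : ℤ) :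
    yy (yv n π) i m = yv n π i m := by
  unfold yy
  split_ifs with h
  · rfl
  · rw [yv, dif_neg]
    intro h'
    have := okp_two h'
    omega

lemma yy_ne (n : ℕ → ℕ) (π : ∀ i, FreeGroup (Fin (n i)) →* G i) (i : ℕ) (m : ℤ)
    (h : yy (yv n π) i m ≠ 1) : ∃ j : ℕ, m = 2 ^ j ∧ i < j := by
  rw [yy_yv, yv] at h
  split_ifs at h with h'
  · have h2 := okp_two h'
    obtain ⟨h3, h4, h5, h6⟩ := h'
    refine ⟨lab m.toNat, ?_, ?_⟩
    · have : ((2 ^ lab m.toNat : ℕ) : ℤ) = (m.toNat : ℤ) := by rw [h3]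
      push_cast at this
      rw [this]; omega
    · rw [← h5]
      have := Nat.unpair_left_le (lab m.toNat - 1)
      omega
  · exact absurd rfl h

lemma yy_mem (n : ℕ → ℕ) (π : ∀ i, FreeGroup (Fin (n i)) →* G i) (i : ℕ) (m : ℤ) :
    yy (yv n π) i m = 1 ∨ yy (yv n π) i m ∈ gset (π i) := by
  rw [yy_yv, yv]
  split_ifs with h
  · right; rw [gset_mem]; exact ⟨_, rfl⟩
  · left; rfl

lemma toNat_pow (j : ℕ) : ((2 : ℤ) ^ j).toNat = 2 ^ j := by
  have : ((2 : ℤ) ^ j) = ((2 ^ j : ℕ) : ℤ) := by push_cast; rfl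
  rw [this, Int.toNat_natCast]

lemma yy_gen (n : ℕ → ℕ) (π : ∀ i, FreeGroup (Fin (n i)) →* G i) (i : ℕ) (a : Fin (n i)) :
    yy (yv n π) i (2 ^ (Nat.pair i a + 1)) = π i (FreeGroup.of a) := by
  rw [yy_yv, yv, dif_pos]
  · congr 2
    ext
    simp [toNat_pow, lab_pow]
  · simp [toNat_pow, lab_pow, okp]

lemma yy_gen_ne (n : ℕ → ℕ) (π : ∀ i, FreeGroup (Fin (n i)) →* G i) (i i' : ℕ) (a : ℕ)
    (h : i' ≠ i) : yy (yv n π) i' (2 ^ (Nat.pair i a + 1)) = 1 := by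
  rw [yy_yv, yv, dif_neg]
  simp [toNat_pow, lab_pow, okp]
  intro h'; exact absurd h'.symm h

lemma dlt_range (n : ℕ → ℕ) (π : ∀ i, FreeGroup (Fin (n i)) →* G i)
    (hπ : ∀ i, Function.Surjective (π i)) (i : ℕ) (g : G i) :
    dlt i g ∈ (rho (yv n π)).range := by
  have hg := gset_gen (π i) (hπ i)
  unfold Generates at hg
  have : Subgroup.closure (gset (π i) : Set (G i)) ≤ (rho (yv n π)).range.comap (dlt i) := by
    rw [Subgroup.closure_le]
    intro x hx
    obtain ⟨a, rfl⟩ := (gset_mem _ _).1 hx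
    have := dlt_mem (yv n π) (yy_ne n π) i (Nat.pair i a + 1) (by omega)
      (fun i' h => yy_gen_ne n π i i' a h)
    rw [yy_gen] at this
    exact this
  rw [hg] at this
  exact this (Subgroup.mem_top g)

/-- Simulation relation between machine states and points. -/
def Rel (n : ℕ → ℕ) (π : ∀ i, FreeGroup (Fin (n i)) →* G i) (i : ℕ) (s : St) (p : ℤ × ℤ × G i) :
    Prop :=
  p.1 = (s.1.1.1 : ℤ) - s.1.1.2 ∧ p.2.1 = (s.1.2.1 : ℤ) - s.1.2.2 ∧
    ∃ v : List (Fin (n i) × Bool), s.2 = v.map (fun p => ((p.1 : ℕ), p.2)) ∧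
      p.2.2 = π i (FreeGroup.mk v)

lemma mk_cons' {α : Type*} (a : α) (b : Bool) (v : List (α × Bool)) :
    FreeGroup.mk ((a, b) :: v) =
      (cond b (FreeGroup.of a) (FreeGroup.of a)⁻¹) * FreeGroup.mk v := by
  cases b <;> simp [FreeGroup.of, FreeGroup.invRev]

lemma Rel_word (n : ℕ → ℕ) (π : ∀ i, FreeGroup (Fin (n i)) →* G i) (i : ℕ)
    (b : Bool) (A B c d : ℕ) (m k : ℤ) (hm : m = (A : ℤ) - B) (hk : k = (c : ℤ) - d)
    (v : List (Fin (n i) × Bool)) :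
    ∃ v' : List (Fin (n i) × Bool),
      (if d ≤ c ∧ okp i (n i) (A - B) then
        ((lab (A - B) - 1).unpair.2, b) :: v.map (fun p => ((p.1 : ℕ), p.2))
        else v.map (fun p => ((p.1 : ℕ), p.2))) = v'.map (fun p => ((p.1 : ℕ), p.2)) ∧
      (cond b (cc (yv n π) i m k) (cc (yv n π) i m k)⁻¹) * π i (FreeGroup.mk v) =
        π i (FreeGroup.mk v') := by
  have hmn : m.toNat = A - B := by omega
  by_cases h : d ≤ c ∧ okp i (n i) (A - B)
  · rw [if_pos h]
    refine ⟨(⟨(lab (A - B) - 1).unpair.2, h.2.2.2.2⟩, b) :: v, by simp, ?_⟩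
    rw [mk_cons', map_mul]
    have : cc (yv n π) i m k = π i (FreeGroup.of ⟨(lab (A - B) - 1).unpair.2, h.2.2.2.2⟩) := by
      rw [cc, if_pos (by omega), yy_yv, yv, dif_pos (by rw [hmn]; exact h.2)]
      simp only [hmn]
    rw [this]
    cases b <;> simp
  · rw [if_neg h]
    refine ⟨v, rfl, ?_⟩
    have : cc (yv n π) i m k = 1 := by
      rw [cc]
      split_ifs with h1
      · rw [yy_yv, yv, dif_neg]
        rw [hmn]
        intro h2
        exact h ⟨by omega, h2⟩
      · rfl
    rw [this]
    cases b <;> simp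

lemma Rel_step (n : ℕ → ℕ) (π : ∀ i, FreeGroup (Fin (n i)) →* G i) (i : ℕ) (s : St)
    (p : ℤ × ℤ × G i) (h : Rel n π i s p) (x : Fin 2) (b : Bool) :
    Rel n π i (step (i, n i) (x, b) s)
      ((cond b (gens (yv n π) x) (gens (yv n π) x)⁻¹) i p) := by
  obtain ⟨⟨⟨A, B⟩, ⟨c, d⟩⟩, u⟩ := s
  obtain ⟨m, k, g⟩ := p
  obtain ⟨h1, h2, v, h3, h4⟩ := h
  simp only at h1 h2 h3 h4
  have hm1 : m = 1 ↔ A = B + 1 := by omega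
  obtain ⟨v', hv1, hv2⟩ := Rel_word n π i b A B c d m k h1 h2 v
  fin_cases x
  · cases b
    · refine ⟨?_, ?_, v, ?_, ?_⟩ <;> simp [step, gens, SS_inv_apply, h1, h2, h3, h4]; ring
    · refine ⟨?_, ?_, v, ?_, ?_⟩ <;> simp [step, gens, SS_apply, h1, h2, h3, h4]; ring
  · cases b
    · refine ⟨?_, ?_, v', ?_, ?_⟩
      · simp [step, gens, TT_inv_apply, h1]
      · simp only [step, gens, TT_inv_apply, h2, hm1, Fin.mk_one, Matrix.cons_val_one,
          Matrix.cons_val_fin_one, cond_false, Pi.inv_apply, one_ne_zero, if_false, Bool.false_eq_true]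
        split_ifs <;> push_cast <;> ring
      · rw [← hv1, ← h3]; simp [step]
      · rw [← hv2, ← h4]; simp [gens, TT_inv_apply]
    · refine ⟨?_, ?_, v', ?_, ?_⟩
      · simp [step, gens, TT_apply, h1]
      · simp only [step, gens, TT_apply, h2, hm1, Fin.mk_one, Matrix.cons_val_one,
          Matrix.cons_val_fin_one, cond_true, one_ne_zero, if_false, if_true]
        split_ifs <;> push_cast <;> ring
      · rw [← hv1, ← h3]; simp [step]
      · rw [← hv2, ← h4]; simp [gens, TT_apply]

lemma Rel_run (n : ℕ → ℕ) (π : ∀ i, FreeGroup (Fin (n i)) →* G i) (i : ℕ) (s : St)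
    (p : ℤ × ℤ × G i) (h : Rel n π i s p) (w : Wd) :
    Rel n π i (runw (i, n i) w s) (rho (yv n π) (FreeGroup.mk w) i p) := by
  induction w with
  | nil => simpa [runw, rho] using h
  | cons a w ih =>
    obtain ⟨x, b⟩ := a
    rw [rho_cons, Pi.mul_apply, Perm.mul_apply]
    exact Rel_step n π i _ _ ih x b

/-- The base points. -/
def pm (t : ℕ) : ℤ := ((st0 t).1.1.1 : ℤ) - (st0 t).1.1.2
def pk (t : ℕ) : ℤ := ((st0 t).1.2.1 : ℤ) - (st0 t).1.2.2
def ep (t : ℕ) : ℤ × ℤ × G (ix t) := (pm t, pk t, 1)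

lemma int_split (m : ℤ) (N : ℕ) (h : |m| ≤ N) : ∃ a b : ℕ, a ≤ N ∧ b ≤ N ∧ m = (a : ℤ) - b := by
  obtain ⟨h1, h2⟩ := abs_le.1 h
  exact ⟨m.toNat, (-m).toNat, by omega, by omega, by omega⟩

lemma ep_surj (m k : ℤ) (i N : ℕ) (hm : |m| ≤ N) (hk : |k| ≤ N) (hi : i ≤ N) :
    ∃ t < (N + 1) ^ 8, pm t = m ∧ pk t = k ∧ ix t = i := by
  obtain ⟨a, b, ha, hb, rfl⟩ := int_split m N hm
  obtain ⟨c, d, hc, hd, rfl⟩ := int_split k N hk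
  refine ⟨Nat.pair (Nat.pair (Nat.pair a b) (Nat.pair c d)) i, ?_, ?_, ?_, ?_⟩
  · have hp : ∀ {x y M : ℕ}, x < M → y < M → Nat.pair x y < M ^ 2 := by
      intro x y M hx hy
      refine lt_of_lt_of_le (Nat.pair_lt_max_add_one_sq x y) ?_
      exact Nat.pow_le_pow_left (by omega) 2
    have h1 := hp (Nat.lt_succ_of_le ha) (Nat.lt_succ_of_le hb)
    have h2 := hp (Nat.lt_succ_of_le hc) (Nat.lt_succ_of_le hd)
    have h3 := hp h1 h2
    have h4 : i < ((N + 1) ^ 2) ^ 2 := by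
      rw [← pow_mul]
      exact lt_of_lt_of_le (Nat.lt_succ_of_le hi) (Nat.le_self_pow (by norm_num) _)
    have h5 := hp h3 h4
    rw [← pow_mul, ← pow_mul] at h5
    exact h5
  · simp [pm, st0]
  · simp [pk, st0]
  · simp [ix]

abbrev Lx (G : ℕ → Type) (i : ℕ) := ℤ ×ₗ (ℤ ×ₗ G i)

def toL (i : ℕ) (p : ℤ × ℤ × G i) : Lx G i := toLex (p.1, toLex p.2)

lemma toL_inj (i : ℕ) (p q : ℤ × ℤ × G i) (h : toL i p = toL i q) : p = q := h

lemma toL_lt [∀ i, LinearOrder (G i)] (i : ℕ) (p q : ℤ × ℤ × G i) :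
    toL i p < toL i q ↔ p.1 < q.1 ∨ p.1 = q.1 ∧ (p.2.1 < q.2.1 ∨ p.2.1 = q.2.1 ∧ p.2.2 < q.2.2) := by
  simp [toL, Prod.Lex.toLex_lt_toLex]

def keyf (y : ∀ i, ℤ → G i) (h : (rho y).range) : Lex (∀ t, Lx G (ix t)) :=
  toLex fun t => toL (ix t) (h.1 (ix t) (ep t))

lemma keyf_inj (y : ∀ i, ℤ → G i) : Function.Injective (keyf y) := by
  intro h h' heq
  have hh : ∀ t, h.1 (ix t) (ep t) = h'.1 (ix t) (ep t) := fun t =>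
    toL_inj _ _ _ (congrFun (toLex.injective heq) t)
  obtain ⟨w, hw⟩ := exists_word y h
  obtain ⟨w', hw'⟩ := exists_word y h'
  apply Subtype.ext
  funext i
  ext1 ⟨m, k, g⟩
  obtain ⟨t, -, h1, h2, h3⟩ := ep_surj m k i (m.natAbs + k.natAbs + i) 
    (by rw [Int.abs_eq_natAbs]; omega) (by rw [Int.abs_eq_natAbs]; omega)
    (by omega)
  subst h1 h2 h3
  have := hh t
  rw [hw, hw'] at this ⊢
  rw [ep, rho_apply, rho_apply] at this
  simp only [Prod.mk.injEq, mul_one] at this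
  rw [rho_apply, rho_apply, this.1, this.2.1, this.2.2]

noncomputable def ordH (l : ∀ i, LinearOrder (G i)) (y : ∀ i, ℤ → G i) :
    LinearOrder (rho y).range :=
  LinearOrder.lift' (keyf y) (keyf_inj y)

lemma ordH_lt (l : ∀ i, LinearOrder (G i)) (y : ∀ i, ℤ → G i) (h h' : (rho y).range) :
    (ordH l y).lt h h' ↔ ∃ t, (∀ j < t, h.1 (ix j) (ep j) = h'.1 (ix j) (ep j)) ∧
      toL (ix t) (h.1 (ix t) (ep t)) < toL (ix t) (h'.1 (ix t) (ep t)) := Iff.rfl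

lemma mono_word (l : ∀ i, LinearOrder (G i))
    (hl : ∀ i, ∀ a b c : G i, (l i).le b c → (l i).le (a * b) (a * c))
    (y : ∀ i, ℤ → G i) (w : Wd) (i : ℕ) (p q : ℤ × ℤ × G i) (h : toL i p < toL i q) :
    toL i (rho y (FreeGroup.mk w) i p) < toL i (rho y (FreeGroup.mk w) i q) := by
  obtain ⟨m, k, g⟩ := p
  obtain ⟨m', k', g'⟩ := q
  rw [rho_apply, rho_apply]
  rw [toL_lt] at h ⊢
  simp only at h ⊢
  rcases h with h | ⟨rfl, h | ⟨rfl, h⟩⟩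
  · left; linarith
  · right; refine ⟨rfl, Or.inl (by linarith)⟩
  · right; refine ⟨rfl, Or.inr ⟨rfl, ?_⟩⟩
    refine lt_of_le_of_ne (hl i _ _ _ h.le) ?_
    intro h'
    exact h.ne (mul_left_cancel h')

lemma ordH_inv (l : ∀ i, LinearOrder (G i))
    (hl : ∀ i, ∀ a b c : G i, (l i).le b c → (l i).le (a * b) (a * c))
    (y : ∀ i, ℤ → G i) (a b c : (rho y).range) (h : (ordH l y).le b c) :
    (ordH l y).le (a * b) (a * c) := by
  letI := ordH l y
  have h' : b ≤ c := h
  change a * b ≤ a * c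
  rcases h'.lt_or_eq with h1 | rfl
  · apply le_of_lt
    obtain ⟨t, h2, h3⟩ := (ordH_lt l y b c).1 h1
    refine (ordH_lt l y (a * b) (a * c)).2 ⟨t, ?_, ?_⟩
    · intro j hj
      change a.1 _ (b.1 _ _) = a.1 _ (c.1 _ _)
      rw [h2 j hj]
    · change toL _ (a.1 _ (b.1 _ _)) < toL _ (a.1 _ (c.1 _ _))
      obtain ⟨w, hw⟩ := exists_word y a
      rw [hw]
      exact mono_word l hl y w _ _ _ h3
  · exact le_rfl

open Classical in
lemma sgnAt_spec (n : ℕ → ℕ) (π : ∀ i, FreeGroup (Fin (n i)) →* G i)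
    (l : ∀ i, LinearOrder (G i)) (F : ℕ × List (ℕ × Bool) → ℤ)
    (hFc : ∀ i (w : List (Fin (n i) × Bool)),
      F (i, w.map (fun p => ((p.1 : ℕ), p.2))) = orderSign (l i) (π i (FreeGroup.mk w)))
    (w : Wd) (t : ℕ) :
    sgnAt n F w t = if toL (ix t) (rho (yv n π) (FreeGroup.mk w) (ix t) (ep t)) <
        toL (ix t) (ep t) then -1
      else if rho (yv n π) (FreeGroup.mk w) (ix t) (ep t) = ep t then 0 else 1 := by
  have h0 : Rel n π (ix t) (st0 t) (ep t) := ⟨rfl, rfl, [], by simp [st0], by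
    simp [ep, ← FreeGroup.one_eq_mk]⟩
  have hR := Rel_run n π (ix t) (st0 t) (ep t) h0 w
  generalize rho (yv n π) (FreeGroup.mk w) (ix t) (ep t) = p at hR ⊢
  obtain ⟨m, k, g⟩ := p
  obtain ⟨h1, h2, v, h3, h4⟩ := hR
  unfold sgnAt
  rw [h3, hFc, ← h4]
  simp only [toL_lt]
  simp only at h1 h2
  simp only [pre, ep, Prod.mk.injEq, orderSign]
  generalize runw (ix t, n (ix t)) w (st0 t) = s at *
  have e1 : m < pm t ↔ s.1.1.1 + (st0 t).1.1.2 < (st0 t).1.1.1 + s.1.1.2 := by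
    unfold pm; omega
  have e2 : pm t < m ↔ (st0 t).1.1.1 + s.1.1.2 < s.1.1.1 + (st0 t).1.1.2 := by
    unfold pm; omega
  have e3 : k < pk t ↔ s.1.2.1 + (st0 t).1.2.2 < (st0 t).1.2.1 + s.1.2.2 := by
    unfold pk; omega
  have e4 : pk t < k ↔ (st0 t).1.2.1 + s.1.2.2 < s.1.2.1 + (st0 t).1.2.2 := by
    unfold pk; omega
  simp only [← e1, ← e2, ← e3, ← e4]
  rcases lt_trichotomy m (pm t) with hm | hm | hm
  · simp [hm]
  · rcases lt_trichotomy k (pk t) with hk | hk | hk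
    · simp [hm, hk]
    · simp [hm, hk]
    · simp [hm, hk, hk.not_gt, hk.ne']
  · simp [hm, hm.not_gt, hm.ne']

lemma order_main (n : ℕ → ℕ) (hn : Computable n) (π : ∀ i, FreeGroup (Fin (n i)) →* G i)
    (l : ∀ i, LinearOrder (G i))
    (hl : ∀ i, ∀ a b c : G i, (l i).le b c → (l i).le (a * b) (a * c))
    (F : ℕ × List (ℕ × Bool) → ℤ) (hF : Computable F)
    (hFc : ∀ i (w : List (Fin (n i) × Bool)),
      F (i, w.map (fun p => ((p.1 : ℕ), p.2))) = orderSign (l i) (π i (FreeGroup.mk w))) :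
    ComputableLeftOrderVia (rho (yv n π)).rangeRestrict := by
  refine ⟨ordH l (yv n π), ordH_inv l hl _, ?_⟩
  refine (comp_FN n hn F hF).of_eq fun w => ?_
  have hs := sgnAt_spec n π l F hFc w
  have hz : ∀ t, sgnAt n F w t = 0 → rho (yv n π) (FreeGroup.mk w) (ix t) (ep t) = ep t := by
    intro t ht
    rw [hs] at ht
    by_contra hc
    rw [if_neg hc] at ht
    split_ifs at ht <;> omega
  have hval : ((rho (yv n π)).rangeRestrict (FreeGroup.mk w)).1 = rho (yv n π) (FreeGroup.mk w) := rfl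
  unfold orderSign
  by_cases h0 : FN (sgnAt n F w) (bnd w) = 0
  · have hone : (rho (yv n π)).rangeRestrict (FreeGroup.mk w) = 1 := by
      apply Subtype.ext
      rw [hval]
      apply rho_eq_one _ (yy_ne n π)
      intro m k i hm hk hi
      obtain ⟨t, ht, h1, h2, h3⟩ := ep_surj m k i (5 * w.length + 2) (by push_cast; exact hm)
        (by push_cast; exact hk) hi
      subst h1 h2 h3
      exact hz t (FN_zero _ _ h0 t ht)
    rw [h0, hone, if_neg (fun hlt => @lt_irrefl _ (ordH l (yv n π)).toPreorder _ hlt), if_pos rfl]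
  · obtain ⟨t, -, h1, h2⟩ := FN_ne _ _ h0
    have hpre : ∀ j < t, rho (yv n π) (FreeGroup.mk w) (ix j) (ep j) = ep j :=
      fun j hj => hz j (h1 j hj)
    rw [← h2] at h0 ⊢
    rw [hs] at h0 ⊢
    by_cases c1 : toL (ix t) (rho (yv n π) (FreeGroup.mk w) (ix t) (ep t)) < toL (ix t) (ep t)
    · rw [if_pos c1, if_pos]
      exact (ordH_lt _ _ _ _).2 ⟨t, hpre, c1⟩
    · rw [if_neg c1] at h0 ⊢
      by_cases c2 : rho (yv n π) (FreeGroup.mk w) (ix t) (ep t) = ep t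
      · rw [if_pos c2] at h0
        exact absurd rfl h0
      · rw [if_neg c2, if_neg, if_neg]
        · intro h
          apply c2
          rw [← hval, h]
          rfl
        · intro h
          obtain ⟨t', h3, h4⟩ := (ordH_lt _ _ _ _).1 h
          rw [hval] at h3 h4
          rcases lt_trichotomy t' t with h5 | rfl | h5
          · rw [hpre t' h5] at h4
            exact lt_irrefl _ h4
          · exact c1 h4
          · exact c2 (h3 t h5)

end

end Emb

theorem family_computable_left_order_embedding_into_two_generated
    (n : ℕ → ℕ) (hn : Computable n)
    (G : ℕ → Type) [∀ i, Group (G i)]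
    (π : ∀ i, FreeGroup (Fin (n i)) →* G i) (hπ : ∀ i, Function.Surjective (π i))
    (l : ∀ i, LinearOrder (G i))
    (hl : ∀ i, ∀ a b c : G i, (l i).le b c → (l i).le (a * b) (a * c))
    (F : ℕ × List (ℕ × Bool) → ℤ) (hF : Computable F)
    (hFc : ∀ i (w : List (Fin (n i) × Bool)),
      F (i, w.map (fun p => ((p.1 : ℕ), p.2))) = orderSign (l i) (π i (FreeGroup.mk w))) :
    ∃ (H : Type) (_ : Group H) (ρ : FreeGroup (Fin 2) →* H),
      Function.Surjective ρ ∧ ComputableLeftOrderVia ρ ∧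
      ∀ i, ∃ (X : Finset (G i)) (Y : Finset H) (φ : G i →* H),
        Generates X ∧ Generates Y ∧ IsQIEmbedding X Y φ ∧ IsFrattini φ := by
  refine ⟨(Emb.rho (Emb.yv n π)).range, inferInstance, (Emb.rho (Emb.yv n π)).rangeRestrict,
    MonoidHom.rangeRestrict_surjective _, Emb.order_main n hn π l hl F hF hFc, fun i => ?_⟩
  have hX := Emb.gset_gen (π i) (hπ i)
  refine ⟨Emb.gset (π i), Emb.gset (Emb.rho (Emb.yv n π)).rangeRestrict,
    (Emb.dlt i).codRestrict _ (Emb.dlt_range n π hπ i), hX,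
    Emb.gset_gen _ (MonoidHom.rangeRestrict_surjective _), ?_, ?_⟩
  · exact Emb.qi _ i _ hX (Emb.yy_mem n π i) _
  · exact Emb.frattini _ i _
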